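/- Fix q ∈ (0,1) and let h be a k-layer MP-GNN with damping q built from maps φ_1,…,φ_{k+1} and ψ, where φ_i is C_i-Lipschitz for each i = 1,…,k+1 and ψ is C-Lipschitz. Then for any two ℝ^d-labeled weighted graphs (G₁,ℓ_{G₁}) and (G₂,ℓ_{G₂}): |h((G₁,ℓ_{G₁})) − h((G₂,ℓ_{G₂}))| ≤ C · (∏_{i=1}^{k+1} C_i) · d_{G,q}^(k)((G₁,ℓ_{G₁}),(G₂,ℓ_{G₂})). -/

import Mathlib

open Finset

noncomputable section

/-- An ℝ^d-labeled finite edge-weighted graph: nonempty vertex set `Fin n`, symmetric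
nonnegative weights with zero diagonal (an edge is present exactly when its weight is
positive), and vertex labels in `ℝ^d`. -/
structure LabeledGraph (d : ℕ) where
  n : ℕ
  n_pos : 0 < n
  w : Fin n → Fin n → ℝ
  w_nonneg : ∀ u v, 0 ≤ w u v
  w_symm : ∀ u v, w u v = w v u
  w_loopless : ∀ v, w v v = 0
  label : Fin n → EuclideanSpace ℝ (Fin d)

namespace LabeledGraph

variable {d : ℕ}

/-- The (weighted) degree `deg(v) = Σ_{v'} w_{vv'}`. -/
def deg (G : LabeledGraph d) (v : Fin G.n) : ℝ := ∑ v', G.w v v'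

/-- The modified degree `d̄eg(v)`. -/
def dbar (G : LabeledGraph d) (v : Fin G.n) : ℝ := if 0 < G.deg v then G.deg v else 1

/-- The stationary measure `μ_G(v) = d̄eg(v)/Σ_{v'} d̄eg(v')`. -/
def statMeas (G : LabeledGraph d) (v : Fin G.n) : ℝ := G.dbar v / ∑ v', G.dbar v'

/-- The `q`-damped Markov kernel `m^{G,q}` of the graph, by its value at `v'`. -/
def kernel (G : LabeledGraph d) (q : ℝ) (v v' : Fin G.n) : ℝ :=
  if 0 < G.deg v then (if v' = v then q else 0) + (1 - q) * G.w v v' / G.deg v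
  else if v' = v then 1 else 0

end LabeledGraph

/-- `π` is a coupling of the two probability vectors `p : A → ℝ` and `p' : B → ℝ`. -/
def IsCouplingFn {A B : Type*} [Fintype A] [Fintype B] (π : A × B → ℝ)
    (p : A → ℝ) (p' : B → ℝ) : Prop :=
  (∀ r, 0 ≤ π r) ∧ (∀ a, ∑ b, π (a, b) = p a) ∧ (∀ b, ∑ a, π (a, b) = p' b)

/-- A 1-step coupling between the Markov kernels `mA` and `mB`. -/
def IsOneStepCoupling {A B : Type*} [Fintype A] [Fintype B]
    (mA : A → A → ℝ) (mB : B → B → ℝ) (ν : A × B → A × B → ℝ) : Prop :=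
  ∀ p, IsCouplingFn (ν p) (mA p.1) (mB p.2)

/-- `k`-step couplings between the Markov kernels `mA` and `mB` (for `k = 0`, the identity
kernel, so that `ν^{(0)} ⊙ γ = γ`). -/
inductive IsKStepCoupling {A B : Type*} [Fintype A] [Fintype B] [DecidableEq A] [DecidableEq B]
    (mA : A → A → ℝ) (mB : B → B → ℝ) : ℕ → (A × B → A × B → ℝ) → Prop
  | zero (ν : A × B → A × B → ℝ) (h : ∀ p r, ν p r = if r = p then 1 else 0) :
      IsKStepCoupling mA mB 0 ν
  | one (ν : A × B → A × B → ℝ) (h : IsOneStepCoupling mA mB ν) : IsKStepCoupling mA mB 1 ν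
  | succ (k : ℕ) (ν' ν₁ ν : A × B → A × B → ℝ) (h' : IsKStepCoupling mA mB k ν')
      (h₁ : IsOneStepCoupling mA mB ν₁) (h : ∀ p r, ν p r = ∑ s, ν₁ p s * ν' s r) :
      IsKStepCoupling mA mB (k + 1) ν

/-- `ν ⊙ γ := ∫ ν_{x,y} γ(dx×dy)`. -/
def odotFn {A B : Type*} [Fintype A] [Fintype B]
    (ν : A × B → A × B → ℝ) (γ : A × B → ℝ) : A × B → ℝ :=
  fun r => ∑ p, γ p * ν p r

/-- The Weisfeiler–Lehman distance of depth `k` between two labeled measure Markov chains on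
finite state spaces, via its `k`-step coupling characterization: the infimum over
`γ^{(k)} = ν^{(k)} ⊙ γ ∈ C^{(k)}(μ_A,μ_B)` of `∫ d_Z(ℓ_A(x),ℓ_B(y)) γ^{(k)}(dx×dy)`. -/
def dWL {A B Z : Type*} [Fintype A] [Fintype B] [DecidableEq A] [DecidableEq B]
    [PseudoMetricSpace Z] (k : ℕ)
    (mA : A → A → ℝ) (μA : A → ℝ) (lA : A → Z)
    (mB : B → B → ℝ) (μB : B → ℝ) (lB : B → Z) : ℝ :=
  sInf {r : ℝ | ∃ γ ν, IsCouplingFn γ μA μB ∧ IsKStepCoupling mA mB k ν ∧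
    r = ∑ p : A × B, odotFn ν γ p * dist (lA p.1) (lB p.2)}

/-- The `q`-damped WL distance of depth `k` between labeled graphs. -/
def dGq {d : ℕ} (q : ℝ) (k : ℕ) (G₁ G₂ : LabeledGraph d) : ℝ :=
  dWL k (G₁.kernel q) G₁.statMeas G₁.label (G₂.kernel q) G₂.statMeas G₂.label

/-- Dimension sequence with prescribed initial value `d` and tail `t`. -/
def dimSeq (d : ℕ) (t : ℕ → ℕ) : ℕ → ℕ
  | 0 => d
  | i + 1 => t i

/-- The node features `ℓ_G^i` computed by the message-passing layers of an MP-GNN with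
damping `q` and maps `φ` (here `φ i` is the paper's `φ_{i+1}`). -/
def gnnLabel (q : ℝ) (dims : ℕ → ℕ)
    (φ : (i : ℕ) → EuclideanSpace ℝ (Fin (dims i)) → EuclideanSpace ℝ (Fin (dims (i + 1))))
    (G : LabeledGraph (dims 0)) : (i : ℕ) → Fin G.n → EuclideanSpace ℝ (Fin (dims i))
  | 0, v => G.label v
  | i + 1, v =>
    if 0 < G.deg v then
      q • φ i (gnnLabel q dims φ G i v) +
        ((1 - q) / G.deg v) • ∑ v', G.w v v' • φ i (gnnLabel q dims φ G i v')
    else φ i (gnnLabel q dims φ G i v)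

/-- The output of a `k`-layer MP-GNN with damping `q`:
`h(G) = ψ( Σ_v (d̄eg(v)/Σ d̄eg) φ_{k+1}(ℓ_G^k(v)) )`. -/
def gnnOut (q : ℝ) (dims : ℕ → ℕ) (k : ℕ)
    (φ : (i : ℕ) → EuclideanSpace ℝ (Fin (dims i)) → EuclideanSpace ℝ (Fin (dims (i + 1))))
    (ψ : EuclideanSpace ℝ (Fin (dims (k + 1))) → ℝ)
    (G : LabeledGraph (dims 0)) : ℝ :=
  ψ (∑ v, G.statMeas v • φ k (gnnLabel q dims φ G k v))

end

section WLLipschitz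

variable {A B E : Type*} [Fintype A] [Fintype B]

/-- The product of two probability vectors is a coupling of them. -/
theorem isCouplingFn_mul {p : A → ℝ} {p' : B → ℝ} (hp : ∀ a, 0 ≤ p a) (hp' : ∀ b, 0 ≤ p' b)
    (hs : ∑ a, p a = 1) (hs' : ∑ b, p' b = 1) :
    IsCouplingFn (fun r : A × B => p r.1 * p' r.2) p p' := by
  refine ⟨fun r => mul_nonneg (hp _) (hp' _), fun a => ?_, fun b => ?_⟩
  · simp [← Finset.mul_sum, hs']
  · simp [← Finset.sum_mul, hs]

theorem IsCouplingFn.sum_smul_sub_sum_smul [AddCommGroup E] [Module ℝ E] {π : A × B → ℝ}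
    {p : A → ℝ} {p' : B → ℝ} (h : IsCouplingFn π p p') (f : A → E) (g : B → E) :
    ∑ a, p a • f a - ∑ b, p' b • g b = ∑ r, π r • (f r.1 - g r.2) := by
  simp only [smul_sub, Finset.sum_sub_distrib, ← h.2.1, ← h.2.2, Finset.sum_smul]
  rw [Fintype.sum_prod_type, Fintype.sum_prod_type_right]

theorem IsCouplingFn.dist_sum_smul_le [SeminormedAddCommGroup E] [NormedSpace ℝ E]
    {π : A × B → ℝ} {p : A → ℝ} {p' : B → ℝ} (h : IsCouplingFn π p p') (f : A → E) (g : B → E) :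
    dist (∑ a, p a • f a) (∑ b, p' b • g b) ≤ ∑ r, π r * dist (f r.1) (g r.2) := by
  rw [dist_eq_norm, h.sum_smul_sub_sum_smul]
  refine (norm_sum_le _ _).trans (Finset.sum_le_sum fun r _ => ?_)
  rw [norm_smul, Real.norm_of_nonneg (h.1 r), dist_eq_norm]

/-- Couplings contract through a Lipschitz map, followed by a bound on the distances between
the arguments. -/
theorem IsCouplingFn.dist_sum_smul_le_of_lipschitz {X : Type*} [PseudoMetricSpace X]
    [SeminormedAddCommGroup E] [NormedSpace ℝ E] {π : A × B → ℝ} {p : A → ℝ} {p' : B → ℝ}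
    (h : IsCouplingFn π p p') {K : NNReal} {φ : X → E} (hφ : LipschitzWith K φ)
    (f : A → X) (g : B → X) {c : ℝ} {D : A × B → ℝ}
    (hD : ∀ r, dist (f r.1) (g r.2) ≤ c * D r) :
    dist (∑ a, p a • φ (f a)) (∑ b, p' b • φ (g b)) ≤ c * K * ∑ r, π r * D r := by
  refine (h.dist_sum_smul_le _ _).trans ?_
  rw [Finset.mul_sum]
  refine Finset.sum_le_sum fun r _ => ?_
  calc π r * dist (φ (f r.1)) (φ (g r.2))
      ≤ π r * (K * (c * D r)) :=
        mul_le_mul_of_nonneg_left ((hφ.dist_le_mul _ _).trans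
          (mul_le_mul_of_nonneg_left (hD r) K.coe_nonneg)) (h.1 r)
    _ = c * K * (π r * D r) := by ring

variable [DecidableEq A] [DecidableEq B]

theorem exists_isKStepCoupling {mA : A → A → ℝ} {mB : B → B → ℝ} {ν₁ : A × B → A × B → ℝ}
    (h : IsOneStepCoupling mA mB ν₁) (k : ℕ) : ∃ ν, IsKStepCoupling mA mB k ν := by
  induction k with
  | zero => exact ⟨_, .zero _ fun _ _ => rfl⟩
  | succ k ih =>
    obtain ⟨ν', h'⟩ := ih
    exact ⟨_, .succ k ν' ν₁ _ h' h fun _ _ => rfl⟩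

end WLLipschitz

namespace LabeledGraph

variable {d : ℕ} (G : LabeledGraph d)

theorem dbar_pos (v : Fin G.n) : 0 < G.dbar v := by
  unfold dbar
  split_ifs with h
  exacts [h, one_pos]

theorem sum_dbar_pos : 0 < ∑ v, G.dbar v :=
  Finset.sum_pos (fun v _ => G.dbar_pos v) ⟨⟨0, G.n_pos⟩, Finset.mem_univ _⟩

theorem statMeas_nonneg (v : Fin G.n) : 0 ≤ G.statMeas v :=
  div_nonneg (G.dbar_pos v).le G.sum_dbar_pos.le

theorem sum_statMeas : ∑ v, G.statMeas v = 1 := by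
  simp only [statMeas, ← Finset.sum_div]
  exact div_self G.sum_dbar_pos.ne'

variable {q : ℝ}

theorem kernel_nonneg (hq0 : 0 ≤ q) (hq1 : q ≤ 1) (v v' : Fin G.n) : 0 ≤ G.kernel q v v' := by
  unfold kernel
  have hw : 0 ≤ (1 - q) * G.w v v' := mul_nonneg (sub_nonneg.2 hq1) (G.w_nonneg v v')
  split_ifs <;> positivity

theorem sum_kernel (v : Fin G.n) : ∑ v', G.kernel q v v' = 1 := by
  unfold kernel
  by_cases h : 0 < G.deg v
  · simp only [h, if_true, Finset.sum_add_distrib, Finset.sum_ite_eq', Finset.mem_univ,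
      ← Finset.sum_div, ← Finset.mul_sum]
    change q + (1 - q) * G.deg v / G.deg v = 1
    field_simp
    ring
  · simp [h]

theorem sum_kernel_smul {E : Type*} [AddCommGroup E] [Module ℝ E] (v : Fin G.n)
    (f : Fin G.n → E) :
    ∑ v', G.kernel q v v' • f v' =
      if 0 < G.deg v then q • f v + ((1 - q) / G.deg v) • ∑ v', G.w v v' • f v' else f v := by
  unfold kernel
  by_cases h : 0 < G.deg v
  · simp [h, add_smul, Finset.sum_add_distrib, ite_smul, Finset.smul_sum, smul_smul,
      mul_div_right_comm]
  · simp [h, ite_smul]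

end LabeledGraph

theorem gnnLabel_succ (q : ℝ) (dims : ℕ → ℕ)
    (φ : (i : ℕ) → EuclideanSpace ℝ (Fin (dims i)) → EuclideanSpace ℝ (Fin (dims (i + 1))))
    (G : LabeledGraph (dims 0)) (i : ℕ) (v : Fin G.n) :
    gnnLabel q dims φ G (i + 1) v =
      ∑ v', G.kernel q v v' • φ i (gnnLabel q dims φ G i v') := by
  rw [G.sum_kernel_smul, gnnLabel]

/-- The depth-`k` node features are Lipschitz with respect to `k`-step couplings. -/
theorem dist_gnnLabel_le (q : ℝ) (dims : ℕ → ℕ)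
    (φ : (i : ℕ) → EuclideanSpace ℝ (Fin (dims i)) → EuclideanSpace ℝ (Fin (dims (i + 1))))
    (Cs : ℕ → NNReal) (G₁ G₂ : LabeledGraph (dims 0)) {k : ℕ}
    (hφ : ∀ i < k, LipschitzWith (Cs i) (φ i))
    {ν : Fin G₁.n × Fin G₂.n → Fin G₁.n × Fin G₂.n → ℝ}
    (hν : IsKStepCoupling (G₁.kernel q) (G₂.kernel q) k ν) (p : Fin G₁.n × Fin G₂.n) :
    dist (gnnLabel q dims φ G₁ k p.1) (gnnLabel q dims φ G₂ k p.2) ≤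
      (∏ i ∈ Finset.range k, (Cs i : ℝ)) *
        ∑ r, ν p r * dist (G₁.label r.1) (G₂.label r.2) := by
  induction hν generalizing p with
  | zero ν h => simp [h, gnnLabel]
  | one ν h =>
    rw [gnnLabel_succ, gnnLabel_succ, Finset.prod_range_succ]
    exact (h p).dist_sum_smul_le_of_lipschitz (hφ 0 one_pos) _ _ fun r => by simp [gnnLabel]
  | succ k ν' ν₁ ν h' h₁ h ih =>
    rw [gnnLabel_succ, gnnLabel_succ, Finset.prod_range_succ]
    refine ((h₁ p).dist_sum_smul_le_of_lipschitz (hφ k k.lt_succ_self) _ _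
      (ih fun i hi => hφ i (hi.trans k.lt_succ_self))).trans_eq ?_
    congr 1
    simp only [h, Finset.sum_mul, Finset.mul_sum, mul_assoc]
    exact Finset.sum_comm

theorem gnnOut_lipschitz (q : ℝ) (hq0 : 0 ≤ q) (hq1 : q ≤ 1) (dims : ℕ → ℕ) (k : ℕ)
    (φ : (i : ℕ) → EuclideanSpace ℝ (Fin (dims i)) → EuclideanSpace ℝ (Fin (dims (i + 1))))
    (ψ : EuclideanSpace ℝ (Fin (dims (k + 1))) → ℝ) (Cs : ℕ → NNReal) (C : NNReal)
    (hφ : ∀ i, i ≤ k → LipschitzWith (Cs i) (φ i)) (hψ : LipschitzWith C ψ)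
    (G₁ G₂ : LabeledGraph (dims 0)) :
    |gnnOut q dims k φ ψ G₁ - gnnOut q dims k φ ψ G₂| ≤
      (C : ℝ) * (∏ i ∈ Finset.range (k + 1), (Cs i : ℝ)) * dGq q k G₁ G₂ := by
  have hc : 0 ≤ (C : ℝ) * ∏ i ∈ Finset.range (k + 1), (Cs i : ℝ) := by positivity
  unfold dGq dWL
  rw [← smul_eq_mul (_ * _) (sInf _), ← Real.sInf_smul_of_nonneg hc]
  refine le_csInf (Set.Nonempty.smul_set ?_) ?_
  · obtain ⟨ν, hν⟩ := exists_isKStepCoupling (mA := G₁.kernel q) (mB := G₂.kernel q)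
      (fun p => isCouplingFn_mul (G₁.kernel_nonneg hq0 hq1 p.1) (G₂.kernel_nonneg hq0 hq1 p.2)
        (G₁.sum_kernel p.1) (G₂.sum_kernel p.2)) k
    exact ⟨_, _, ν, isCouplingFn_mul G₁.statMeas_nonneg G₂.statMeas_nonneg
      G₁.sum_statMeas G₂.sum_statMeas, hν, rfl⟩
  · rintro _ ⟨_, ⟨γ, ν, hγ, hν, rfl⟩, rfl⟩
    have key := hγ.dist_sum_smul_le_of_lipschitz (hφ k le_rfl) _ _
      (dist_gnnLabel_le q dims φ Cs G₁ G₂ (fun i hi => hφ i hi.le) hν)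
    rw [← Real.dist_eq]
    refine (hψ.dist_le_mul _ _).trans
      ((mul_le_mul_of_nonneg_left key C.coe_nonneg).trans_eq ?_)
    rw [← Finset.prod_range_succ, ← mul_assoc]
    change _ = _ * _
    congr 1
    simp only [odotFn, Finset.sum_mul, Finset.mul_sum, mul_assoc]
    exact Finset.sum_comm

/-!
STATEMENT 12: Fix `q ∈ (0,1)` and let `h` be a `k`-layer MP-GNN with damping `q` built
from maps `φ_1,…,φ_{k+1}` (here `φ 0, …, φ k`) and `ψ`, where `φ_i` is `C_i`-Lipschitz and
`ψ` is `C`-Lipschitz. Then for any two ℝ^d-labeled weighted graphs,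
`|h(G₁) − h(G₂)| ≤ C · (∏_{i=1}^{k+1} C_i) · d_{G,q}^{(k)}(G₁,G₂)`.
-/
theorem mpgnn_lipschitz_wrt_dWL (q : ℝ) (hq0 : 0 < q) (hq1 : q < 1)
    (d : ℕ) (hd : 1 ≤ d) (k : ℕ) (t : ℕ → ℕ)
    (φ : (i : ℕ) → EuclideanSpace ℝ (Fin (dimSeq d t i)) →
      EuclideanSpace ℝ (Fin (dimSeq d t (i + 1))))
    (ψ : EuclideanSpace ℝ (Fin (dimSeq d t (k + 1))) → ℝ)
    (Cs : ℕ → NNReal) (C : NNReal)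
    (hφ : ∀ i, i ≤ k → LipschitzWith (Cs i) (φ i)) (hψ : LipschitzWith C ψ)
    (G₁ G₂ : LabeledGraph d) :
    |gnnOut q (dimSeq d t) k φ ψ G₁ - gnnOut q (dimSeq d t) k φ ψ G₂| ≤
      (C : ℝ) * (∏ i ∈ Finset.range (k + 1), (Cs i : ℝ)) * dGq q k G₁ G₂ := by
  exact gnnOut_lipschitz q hq0.le hq1.le (dimSeq d t) k φ ψ Cs C hφ hψ G₁ G₂
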